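/- Every element of the group Σ = 𝒮 ∩ ℛ⁴ (under quaternion multiplication) is uniquely expressible as a product w·a_m·a_{m−1}⋯a_2·a_1 where m ≥ 0, w ∈ K, each a_i ∈ C ∪ C', and the a_i alternate between C and C' (consecutive factors a_{i+1}, a_i never both lie in C nor both in C'); uniqueness means the element w and the sequence (a_1, …, a_m) are uniquely determined. Consequently Σ is the amalgamated free product of the groups Δ and Δ' over their common subgroup K. -/

import Mathlib

noncomputable section

/-- The golden ratio τ = (1+√5)/2. -/
def gr : ℝ := (1 + Real.sqrt 5) / 2

/-- The H₄ root system with parameter t (t = τ gives Δ, t = 1-τ = τ' gives Δ'). -/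
def DeltaSet (t : ℝ) : Set (Fin 4 → ℝ) :=
  {x | (∃ i, (x i = 1 ∨ x i = -1) ∧ ∀ j, j ≠ i → x j = 0)
    ∨ (∀ i, x i = 1/2 ∨ x i = -1/2)
    ∨ (∃ σ : Equiv.Perm (Fin 4), Equiv.Perm.sign σ = 1 ∧
        ∃ ε : Fin 4 → ℝ, (∀ i, ε i = 1 ∨ ε i = -1) ∧
          ∀ i, x i = ε i * (![0, 1, 1 - t, t] (σ i)) / 2)}

/-- The identification of ℝ⁴ with the quaternions: (x₁,x₂,x₃,x₄) ↦ x₁ + x₂i + x₃j + x₄k. -/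
def toQ (x : Fin 4 → ℝ) : Quaternion ℝ := ⟨x 0, x 1, x 2, x 3⟩

/-- Δ (t = τ) resp. Δ' (t = τ') as a set of quaternions. -/
def DeltaQ (t : ℝ) : Set (Quaternion ℝ) := toQ '' DeltaSet t

/-- K = Δ ∩ Δ' as a set of quaternions. -/
def KQ : Set (Quaternion ℝ) := toQ '' (DeltaSet gr ∩ DeltaSet (1 - gr))

/-- ℛ = ℤ[1/2, τ], the ring of dyadic golden numbers, as a subset of ℝ. -/
def Rgold : Set ℝ := {x : ℝ | ∃ (a b : ℤ) (n : ℕ), x = ((a : ℝ) + (b : ℝ) * gr) / 2 ^ n}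

/-- Σ = 𝒮 ∩ ℛ⁴ : the unit quaternions all of whose coordinates lie in ℛ. -/
def SigmaQ : Set (Quaternion ℝ) :=
  {q | ‖q‖ = 1 ∧ q.re ∈ Rgold ∧ q.imI ∈ Rgold ∧ q.imJ ∈ Rgold ∧ q.imK ∈ Rgold}

/-- C (t = τ) resp. C' (t = τ'): the chosen representatives
½(0,1,τ',τ), ½(0,−1,τ',τ), ½(0,1,−τ',τ), ½(0,1,τ',−τ) of the nontrivial
right cosets of K in Δ (resp. in Δ', with τ and τ' interchanged). -/
def CQ (t : ℝ) : Set (Quaternion ℝ) :=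
  { ⟨0, 1/2, (1 - t)/2, t/2⟩, ⟨0, -(1/2), (1 - t)/2, t/2⟩,
    ⟨0, 1/2, -((1 - t)/2), t/2⟩, ⟨0, 1/2, (1 - t)/2, -(t/2)⟩ }

/-- Consecutive factors never lie both in C nor both in C'. -/
def altStep (a b : Quaternion ℝ) : Prop :=
  ¬(a ∈ CQ gr ∧ b ∈ CQ gr) ∧ ¬(a ∈ CQ (1 - gr) ∧ b ∈ CQ (1 - gr))

lemma gr_mul_self : gr * gr = gr + 1 := by
  have h : Real.sqrt 5 * Real.sqrt 5 = 5 := Real.mul_self_sqrt (by norm_num)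
  unfold gr
  linear_combination h / 4

lemma irrational_gr : Irrational gr := Real.goldenRatio_irrational

/-- The ring `ℤ[τ]`. -/
def goldenInt : Subring ℝ where
  carrier := {x | ∃ a b : ℤ, x = a + b * gr}
  mul_mem' := by
    rintro _ _ ⟨a, b, rfl⟩ ⟨c, d, rfl⟩
    refine ⟨a * c + b * d, a * d + b * c + b * d, ?_⟩
    push_cast
    linear_combination (b * d : ℝ) * gr_mul_self
  one_mem' := ⟨1, 0, by simp⟩
  add_mem' := by
    rintro _ _ ⟨a, b, rfl⟩ ⟨c, d, rfl⟩
    exact ⟨a + c, b + d, by push_cast; ring⟩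
  zero_mem' := ⟨0, 0, by simp⟩
  neg_mem' := by
    rintro _ ⟨a, b, rfl⟩
    exact ⟨-a, -b, by push_cast; ring⟩

namespace goldenInt

/-- The golden ratio as an element of `ℤ[τ]`. -/
def tau : goldenInt := ⟨gr, 0, 1, by simp⟩

@[simp, norm_cast] lemma coe_two : ((2 : goldenInt) : ℝ) = 2 := rfl

@[simp, norm_cast] lemma coe_four : ((4 : goldenInt) : ℝ) = 4 := rfl

@[simp] lemma coe_tau : (tau : ℝ) = gr := rfl

lemma tau_mul_self : tau * tau = tau + 1 := Subtype.ext gr_mul_self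

lemma exists_eq (s : goldenInt) : ∃ a b : ℤ, s = a + b * tau := by
  obtain ⟨_, a, b, rfl⟩ := s
  exact ⟨a, b, Subtype.ext (by push_cast; rfl)⟩

lemma add_mul_tau_inj {a b c d : ℤ} (h : (a : goldenInt) + b * tau = c + d * tau) :
    a = c ∧ b = d := by
  have h' : (a : ℝ) + b * gr = c + d * gr := by
    have := congrArg (Subtype.val) h
    push_cast at this
    exact this
  have hb : b = d := by
    by_contra hbd
    have hbd' : ((b - d : ℤ) : ℝ) ≠ 0 := by exact_mod_cast sub_ne_zero.mpr hbd
    refine irrational_gr.ne_rat ((c - a : ℤ) / (b - d : ℤ) : ℚ) ?_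
    push_cast at hbd' ⊢
    rw [eq_div_iff hbd']
    linear_combination h'
  subst hb
  exact ⟨by exact_mod_cast add_right_cancel h', rfl⟩

lemma two_dvd_iff (a b : ℤ) : (2 : goldenInt) ∣ a + b * tau ↔ 2 ∣ a ∧ 2 ∣ b := by
  constructor
  · rintro ⟨s, hs⟩
    obtain ⟨c, d, rfl⟩ := exists_eq s
    obtain ⟨rfl, rfl⟩ := @add_mul_tau_inj a b (2 * c) (2 * d)
      (by rw [hs]; push_cast; ring)
    simp
  · rintro ⟨⟨c, rfl⟩, ⟨d, rfl⟩⟩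
    exact ⟨c + d * tau, by push_cast; ring⟩

lemma two_dvd_or_of_mul {s r : goldenInt} (h : 2 ∣ s * r) : 2 ∣ s ∨ 2 ∣ r := by
  obtain ⟨a, b, rfl⟩ := exists_eq s
  obtain ⟨c, d, rfl⟩ := exists_eq r
  rw [show ((a : goldenInt) + b * tau) * (c + d * tau) =
      (a * c + b * d : ℤ) + (a * d + b * c + b * d : ℤ) * tau by
    push_cast; linear_combination (b * d : goldenInt) * tau_mul_self] at h
  simp only [two_dvd_iff] at h ⊢
  simp only [← even_iff_two_dvd, Int.even_add, Int.even_mul] at h ⊢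
  tauto

/-- The points of the projective line over `ℤ[τ]/2 = 𝔽₄`. -/
lemma two_dvd_projective (u v : goldenInt) : 2 ∣ v ∨ 2 ∣ u ∨ 2 ∣ u + v ∨
    2 ∣ u + tau * v ∨ 2 ∣ u + (1 - tau) * v := by
  obtain ⟨a, b, rfl⟩ := exists_eq u
  obtain ⟨c, d, rfl⟩ := exists_eq v
  rw [show (a : goldenInt) + b * tau + (c + d * tau) = (a + c : ℤ) + (b + d : ℤ) * tau by
      push_cast; ring,
    show (a : goldenInt) + b * tau + tau * (c + d * tau) =
      (a + d : ℤ) + (b + c + d : ℤ) * tau by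
      push_cast; linear_combination (d : goldenInt) * tau_mul_self,
    show (a : goldenInt) + b * tau + (1 - tau) * (c + d * tau) =
      (a + c - d : ℤ) + (b - c : ℤ) * tau by
      push_cast; linear_combination (-d : goldenInt) * tau_mul_self]
  simp only [two_dvd_iff]
  simp only [← even_iff_two_dvd, Int.even_add, Int.even_sub]
  tauto

lemma not_two_dvd_one : ¬ (2 : goldenInt) ∣ 1 := by
  have := two_dvd_iff 1 0
  norm_num at this
  exact this

/-- `t` is one of the two roots `τ`, `τ'` of `X² - X - 1`. -/
def IsRoot (t : goldenInt) : Prop := t = tau ∨ t = 1 - tau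

lemma IsRoot.mul_self {t : goldenInt} (ht : IsRoot t) : t * t = t + 1 := by
  rcases ht with rfl | rfl <;> linear_combination tau_mul_self

lemma IsRoot.coe_mul_self {t : goldenInt} (ht : IsRoot t) : (t : ℝ) * t = t + 1 := by
  exact_mod_cast congrArg Subtype.val ht.mul_self

lemma IsRoot.one_sub {t : goldenInt} (ht : IsRoot t) : IsRoot (1 - t) := by
  rcases ht with rfl | rfl
  · exact Or.inr rfl
  · exact Or.inl (by ring)

lemma IsRoot.eq_or_eq_one_sub {u t : goldenInt} (hu : IsRoot u) (ht : IsRoot t) :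
    u = t ∨ u = 1 - t := by
  rcases ht with rfl | rfl <;> rcases hu with rfl | rfl <;> simp

lemma IsRoot.two_dvd_projective {t : goldenInt} (ht : IsRoot t) (u v : goldenInt) :
    2 ∣ v ∨ 2 ∣ u ∨ 2 ∣ u + v ∨ 2 ∣ u + t * v ∨ 2 ∣ u + (1 - t) * v := by
  have h := goldenInt.two_dvd_projective u v
  rcases ht with rfl | rfl
  · exact h
  · rw [sub_sub_cancel]
    tauto

end goldenInt

open goldenInt

/-- The quaternion with coordinates `s` in the `ℤ[τ]`-basis
`(1+i+j+k)/2, (i+(1-t)j+tk)/2, j, k`. -/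
def icosian (t s₀ s₁ s₂ s₃ : goldenInt) : Quaternion ℝ :=
  ⟨s₀ / 2, (s₀ + s₁) / 2, (s₀ + s₁ * (1 - t)) / 2 + s₂, (s₀ + s₁ * t) / 2 + s₃⟩

/-- The quaternion with coordinates `h` in the `ℤ[τ]`-basis `(1+i+j+k)/2, i, j, k`. -/
def hurwitz (h₀ h₁ h₂ h₃ : goldenInt) : Quaternion ℝ :=
  ⟨h₀ / 2, h₀ / 2 + h₁, h₀ / 2 + h₂, h₀ / 2 + h₃⟩

/-- Membership in the order of icosians (for the root `t`). -/
def IsIcosian (t : goldenInt) (x : Quaternion ℝ) : Prop :=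
  ∃ s₀ s₁ s₂ s₃, x = icosian t s₀ s₁ s₂ s₃

/-- Membership in the Hurwitz order with coefficients extended to `ℤ[τ]`. -/
def IsHurwitz (x : Quaternion ℝ) : Prop := ∃ h₀ h₁ h₂ h₃, x = hurwitz h₀ h₁ h₂ h₃

section coordinates

variable (t s₀ s₁ s₂ s₃ : goldenInt)

@[simp] lemma icosian_re : (icosian t s₀ s₁ s₂ s₃).re = s₀ / 2 := rfl

@[simp] lemma icosian_imI : (icosian t s₀ s₁ s₂ s₃).imI = (s₀ + s₁) / 2 := rfl

@[simp] lemma icosian_imJ :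
    (icosian t s₀ s₁ s₂ s₃).imJ = (s₀ + s₁ * (1 - t)) / 2 + s₂ := rfl

@[simp] lemma icosian_imK : (icosian t s₀ s₁ s₂ s₃).imK = (s₀ + s₁ * t) / 2 + s₃ := rfl

@[simp] lemma hurwitz_re : (hurwitz s₀ s₁ s₂ s₃).re = s₀ / 2 := rfl

@[simp] lemma hurwitz_imI : (hurwitz s₀ s₁ s₂ s₃).imI = s₀ / 2 + s₁ := rfl

@[simp] lemma hurwitz_imJ : (hurwitz s₀ s₁ s₂ s₃).imJ = s₀ / 2 + s₂ := rfl

@[simp] lemma hurwitz_imK : (hurwitz s₀ s₁ s₂ s₃).imK = s₀ / 2 + s₃ := rfl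

end coordinates

section arithmetic

variable {t : goldenInt}

lemma icosian_mul (ht : IsRoot t) (r₀ r₁ r₂ r₃ s₀ s₁ s₂ s₃ : goldenInt) :
    icosian t r₀ r₁ r₂ r₃ * icosian t s₀ s₁ s₂ s₃ = icosian t
      (-r₀ * s₀ - r₀ * s₁ - r₀ * s₂ - r₀ * s₃ - r₁ * s₀ - 2 * r₁ * s₁ + (-1 + t) * r₁ * s₂
        - t * r₁ * s₃ - r₂ * s₀ + (-1 + t) * r₂ * s₁ - 2 * r₂ * s₂ - r₃ * s₀ - t * r₃ * s₁
        - 2 * r₃ * s₃)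
      (2 * r₀ * s₀ + (1 + t) * r₀ * s₁ + 2 * r₀ * s₃ + (2 - t) * r₁ * s₀ + 2 * r₁ * s₁
        + (1 - 2 * t) * r₁ * s₂ + r₁ * s₃ + 2 * r₂ * s₀ + r₂ * s₁ + 2 * r₂ * s₂ + 2 * r₂ * s₃
        + (-1 + 2 * t) * r₃ * s₁ - 2 * r₃ * s₂ + 2 * r₃ * s₃)
      (t * r₀ * s₀ + r₀ * s₁ + r₀ * s₂ + (-1 + t) * r₀ * s₃ + (-1 + t) * r₁ * s₀ + t * r₁ * s₁
        - r₁ * s₂ + (-1 + t) * r₁ * s₃ + t * r₂ * s₀ + t * r₂ * s₂ + (-1 + t) * r₂ * s₃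
        + r₃ * s₀ + 2 * r₃ * s₁ + (1 - t) * r₃ * s₂ + t * r₃ * s₃)
      ((1 - t) * r₀ * s₀ - t * r₀ * s₁ + r₀ * s₂ + (1 - t) * r₀ * s₃ + r₁ * s₀
        + (1 - t) * r₁ * s₁ + 2 * r₁ * s₂ - t * r₂ * s₀ - t * r₂ * s₁ + (1 - t) * r₂ * s₂
        - t * r₂ * s₃ + r₃ * s₀ - r₃ * s₁ + t * r₃ * s₂ + (1 - t) * r₃ * s₃) := by
  have h := ht.coe_mul_self
  ext <;> simp only [icosian_re, icosian_imI, icosian_imJ, icosian_imK,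
    Quaternion.re_mul, Quaternion.imI_mul, Quaternion.imJ_mul, Quaternion.imK_mul] <;> push_cast <;>
    clear ht <;>
    generalize (t : ℝ) = t, (r₀ : ℝ) = r₀, (r₁ : ℝ) = r₁, (r₂ : ℝ) = r₂, (r₃ : ℝ) = r₃,
      (s₀ : ℝ) = s₀, (s₁ : ℝ) = s₁, (s₂ : ℝ) = s₂, (s₃ : ℝ) = s₃ at * <;> grind

lemma icosian_one_sub_mul (ht : IsRoot t) (r₀ r₁ r₂ r₃ s₀ s₁ s₂ s₃ : goldenInt) :
    (2 : ℝ) • (icosian (1 - t) r₀ r₁ r₂ r₃ * icosian t s₀ s₁ s₂ s₃) = hurwitz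
      (-2 * r₀ * s₀ - 2 * r₀ * s₁ - 2 * r₀ * s₂ - 2 * r₀ * s₃ - 2 * r₁ * s₀ + r₁ * s₁
        - 2 * t * r₁ * s₂ + (-2 + 2 * t) * r₁ * s₃ - 2 * r₂ * s₀ + (-2 + 2 * t) * r₂ * s₁
        - 4 * r₂ * s₂ - 2 * r₃ * s₀ - 2 * t * r₃ * s₁ - 4 * r₃ * s₃)
      (2 * r₀ * s₀ + (1 + t) * r₀ * s₁ + 2 * r₀ * s₃ + (1 + t) * r₁ * s₀ + (-1 + t) * r₁ * s₁
        + (-1 + 2 * t) * r₁ * s₂ + r₁ * s₃ + 2 * r₂ * s₀ + r₂ * s₁ + 2 * r₂ * s₂ + 2 * r₂ * s₃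
        + (-1 + 2 * t) * r₃ * s₁ - 2 * r₃ * s₂ + 2 * r₃ * s₃)
      (2 * r₀ * s₀ + (2 - t) * r₀ * s₁ + 2 * r₀ * s₂ + r₁ * s₀ - t * r₁ * s₁ + t * r₁ * s₂
        - t * r₁ * s₃ + 2 * r₂ * s₀ + (1 - t) * r₂ * s₁ + 2 * r₂ * s₂ + 2 * r₃ * s₀
        + (1 + t) * r₃ * s₁ + 2 * r₃ * s₃)
      (2 * r₀ * s₀ + r₀ * s₁ + 2 * r₀ * s₂ + 2 * r₀ * s₃ + (2 - t) * r₁ * s₀ - t * r₁ * s₁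
        + (1 + t) * r₁ * s₂ + (1 - t) * r₁ * s₃ - t * r₂ * s₁ + 2 * r₂ * s₂ + 2 * r₃ * s₀
        + t * r₃ * s₁ + 2 * r₃ * s₃) := by
  have h := ht.coe_mul_self
  ext <;> simp only [icosian_re, icosian_imI, icosian_imJ, icosian_imK, hurwitz_re,
    hurwitz_imI, hurwitz_imJ, hurwitz_imK, Quaternion.re_mul, Quaternion.imI_mul,
    Quaternion.imJ_mul, Quaternion.imK_mul, Quaternion.re_smul, Quaternion.imI_smul,
    Quaternion.imJ_smul, Quaternion.imK_smul, smul_eq_mul] <;> push_cast <;>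
    clear ht <;>
    generalize (t : ℝ) = t, (r₀ : ℝ) = r₀, (r₁ : ℝ) = r₁, (r₂ : ℝ) = r₂, (r₃ : ℝ) = r₃,
      (s₀ : ℝ) = s₀, (s₁ : ℝ) = s₁, (s₂ : ℝ) = s₂, (s₃ : ℝ) = s₃ at * <;> grind

lemma icosian_injective {s₀ s₁ s₂ s₃ r₀ r₁ r₂ r₃ : goldenInt}
    (h : icosian t s₀ s₁ s₂ s₃ = icosian t r₀ r₁ r₂ r₃) :
    s₀ = r₀ ∧ s₁ = r₁ ∧ s₂ = r₂ ∧ s₃ = r₃ := by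
  have h₀ : s₀ = r₀ := by
    have := congrArg QuaternionAlgebra.re h
    simp only [icosian_re] at this
    exact Subtype.ext (by linarith)
  have h₁ : s₁ = r₁ := by
    have := congrArg QuaternionAlgebra.imI h
    simp only [icosian_imI, h₀] at this
    exact Subtype.ext (by linarith)
  have h₂ : s₂ = r₂ := by
    have := congrArg QuaternionAlgebra.imJ h
    simp only [icosian_imJ, h₀, h₁] at this
    exact Subtype.ext (by linarith)
  have h₃ : s₃ = r₃ := by
    have := congrArg QuaternionAlgebra.imK h
    simp only [icosian_imK, h₀, h₁] at this
    exact Subtype.ext (by linarith)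
  exact ⟨h₀, h₁, h₂, h₃⟩

lemma hurwitz_eq_icosian (t h₀ h₁ h₂ h₃ : goldenInt) :
    hurwitz h₀ h₁ h₂ h₃ = icosian t h₀ (2 * h₁) (h₂ - h₁ * (1 - t)) (h₃ - h₁ * t) := by
  ext <;> simp <;> ring

lemma icosian_two_mul (t s₀ m s₂ s₃ : goldenInt) :
    icosian t s₀ (2 * m) s₂ s₃ = hurwitz s₀ m (m * (1 - t) + s₂) (m * t + s₃) := by
  ext <;> simp <;> ring

lemma hurwitz_injective {s₀ s₁ s₂ s₃ r₀ r₁ r₂ r₃ : goldenInt}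
    (h : hurwitz s₀ s₁ s₂ s₃ = hurwitz r₀ r₁ r₂ r₃) :
    s₀ = r₀ ∧ s₁ = r₁ ∧ s₂ = r₂ ∧ s₃ = r₃ := by
  rw [hurwitz_eq_icosian 0, hurwitz_eq_icosian 0 r₀] at h
  obtain ⟨h₀, h₁, h₂, h₃⟩ := icosian_injective h
  have h₁' : s₁ = r₁ := by
    have := congrArg Subtype.val h₁
    push_cast at this
    exact Subtype.ext (by linarith)
  subst h₁'
  exact ⟨h₀, rfl, by simpa using h₂, by simpa using h₃⟩

lemma isHurwitz_icosian_iff {s₀ s₁ s₂ s₃ : goldenInt} :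
    IsHurwitz (icosian t s₀ s₁ s₂ s₃) ↔ 2 ∣ s₁ := by
  constructor
  · rintro ⟨h₀, h₁, h₂, h₃, h⟩
    rw [hurwitz_eq_icosian t] at h
    exact ⟨h₁, (icosian_injective h).2.1⟩
  · rintro ⟨m, rfl⟩
    exact ⟨_, _, _, _, icosian_two_mul t s₀ m s₂ s₃⟩

lemma IsHurwitz.isIcosian {x : Quaternion ℝ} (hx : IsHurwitz x) (t : goldenInt) :
    IsIcosian t x := by
  obtain ⟨h₀, h₁, h₂, h₃, rfl⟩ := hx
  exact ⟨_, _, _, _, hurwitz_eq_icosian t h₀ h₁ h₂ h₃⟩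

lemma isHurwitz_of_isIcosian (ht : IsRoot t) {x : Quaternion ℝ} (hx : IsIcosian t x)
    (hx' : IsIcosian (1 - t) x) : IsHurwitz x := by
  obtain ⟨s₀, s₁, s₂, s₃, rfl⟩ := hx
  obtain ⟨r₀, r₁, r₂, r₃, h⟩ := hx'
  rw [isHurwitz_icosian_iff]
  have hre := congrArg QuaternionAlgebra.re h
  have hi := congrArg QuaternionAlgebra.imI h
  have hj := congrArg QuaternionAlgebra.imJ h
  simp only [icosian_re, icosian_imI, icosian_imJ] at hre hi hj
  refine ⟨(r₂ - s₂) * (1 - 2 * t) - 2 * s₁, Subtype.ext ?_⟩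
  have h := ht.coe_mul_self
  push_cast at hj ⊢
  have e : (r₁ : ℝ) = s₁ := by linarith
  have e0 : (r₀ : ℝ) = s₀ := by linarith
  rw [e, e0] at hj
  linear_combination (2 - 4 * (t : ℝ)) * hj - 4 * s₁ * h

lemma normSq_icosian (ht : IsRoot t) (s₀ s₁ s₂ s₃ : goldenInt) :
    Quaternion.normSq (icosian t s₀ s₁ s₂ s₃) =
      (s₀ ^ 2 + s₀ * s₁ + s₀ * s₂ + s₀ * s₃ + s₁ ^ 2 + (1 - t) * s₁ * s₂ + t * s₁ * s₃
        + s₂ ^ 2 + s₃ ^ 2 : goldenInt) := by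
  have h := ht.coe_mul_self
  simp only [Quaternion.normSq_def', icosian_re, icosian_imI, icosian_imJ, icosian_imK]
  push_cast
  linear_combination (s₁ ^ 2 / 2 : ℝ) * h

lemma normSq_hurwitz (h₀ h₁ h₂ h₃ : goldenInt) :
    Quaternion.normSq (hurwitz h₀ h₁ h₂ h₃) =
      (h₀ ^ 2 + h₀ * (h₁ + h₂ + h₃) + h₁ ^ 2 + h₂ ^ 2 + h₃ ^ 2 : goldenInt) := by
  simp only [Quaternion.normSq_def', hurwitz_re, hurwitz_imI, hurwitz_imJ, hurwitz_imK]
  push_cast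
  ring

lemma star_icosian (s₀ s₁ s₂ s₃ : goldenInt) :
    star (icosian t s₀ s₁ s₂ s₃) =
      icosian t s₀ (-s₁ - 2 * s₀) (-t * s₀ - s₂) (-s₀ + s₀ * t - s₃) := by
  ext <;> simp <;> ring

lemma IsIcosian.mul (ht : IsRoot t) {x y : Quaternion ℝ} (hx : IsIcosian t x)
    (hy : IsIcosian t y) : IsIcosian t (x * y) := by
  obtain ⟨s₀, s₁, s₂, s₃, rfl⟩ := hx
  obtain ⟨r₀, r₁, r₂, r₃, rfl⟩ := hy
  exact ⟨_, _, _, _, icosian_mul ht s₀ s₁ s₂ s₃ r₀ r₁ r₂ r₃⟩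

lemma IsIcosian.star {x : Quaternion ℝ} (hx : IsIcosian t x) : IsIcosian t (star x) := by
  obtain ⟨s₀, s₁, s₂, s₃, rfl⟩ := hx
  exact ⟨_, _, _, _, star_icosian s₀ s₁ s₂ s₃⟩

lemma isRoot_tau : IsRoot tau := Or.inl rfl

lemma IsHurwitz.mul {x y : Quaternion ℝ} (hx : IsHurwitz x) (hy : IsHurwitz y) :
    IsHurwitz (x * y) :=
  isHurwitz_of_isIcosian isRoot_tau ((hx.isIcosian _).mul isRoot_tau (hy.isIcosian _))
    ((hx.isIcosian _).mul isRoot_tau.one_sub (hy.isIcosian _))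

lemma IsHurwitz.star {x : Quaternion ℝ} (hx : IsHurwitz x) : IsHurwitz (star x) :=
  isHurwitz_of_isIcosian isRoot_tau (hx.isIcosian _).star (hx.isIcosian _).star

lemma icosian_mul_hurwitz (ht : IsRoot t) (r₀ r₁ r₂ r₃ h₀ h₁ h₂ h₃ : goldenInt) :
    ∃ s₀ s₁ s₂ s₃, icosian t r₀ r₁ r₂ r₃ * hurwitz h₀ h₁ h₂ h₃ = icosian t s₀ s₁ s₂ s₃ ∧
      2 ∣ s₁ - r₁ * (t * h₀ + h₁ + h₂ + h₃) := by
  rw [hurwitz_eq_icosian t, icosian_mul ht]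
  have h := ht.mul_self
  refine ⟨_, _, _, _, rfl, h₀ * r₀ + (1 - t) * h₀ * r₁ + h₀ * r₂ + h₁ * r₀ - t * h₂ * r₁
    + h₂ * r₂ - h₂ * r₃ + h₃ * r₀ + h₃ * r₂ + h₃ * r₃, ?_⟩
  clear ht
  grind

lemma smul_icosian_one_sub_mul (ht : IsRoot t) (r₀ r₁ r₂ r₃ s₀ s₁ s₂ s₃ : goldenInt) :
    ∃ h₀ h₁ h₂ h₃, (2 : ℝ) • (icosian (1 - t) r₀ r₁ r₂ r₃ * icosian t s₀ s₁ s₂ s₃) =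
      hurwitz h₀ h₁ h₂ h₃ ∧ 2 ∣ t * h₀ + h₁ + h₂ + h₃ - r₁ * s₁ := by
  rw [icosian_one_sub_mul ht]
  have h := ht.mul_self
  refine ⟨_, _, _, _, rfl, (3 - t) * r₀ * s₀ + (2 - t) * r₀ * s₁ + (2 - t) * r₀ * s₂
    + (2 - t) * r₀ * s₃ + (2 - t) * r₁ * s₀ - r₁ * s₁ + (-1 + t) * r₁ * s₂
    + (2 - t) * r₁ * s₃ + (2 - t) * r₂ * s₀ + (2 - t) * r₂ * s₁ + (3 - 2 * t) * r₂ * s₂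
    + r₂ * s₃ + (2 - t) * r₃ * s₀ + (-1 + t) * r₃ * s₁ - r₃ * s₂ + (3 - 2 * t) * r₃ * s₃, ?_⟩
  clear ht
  grind

lemma mem_CQ_iff {x : Quaternion ℝ} :
    x ∈ CQ t ↔ x = icosian t 0 1 0 0 ∨ x = icosian t 0 (-1) (1 - t) t ∨
      x = icosian t 0 1 (-1 + t) 0 ∨ x = icosian t 0 1 0 (-t) := by
  have h1 : icosian t 0 1 0 0 = ⟨0, 1 / 2, (1 - t) / 2, t / 2⟩ := by ext <;> simp
  have h2 : icosian t 0 (-1) (1 - t) t = ⟨0, -(1 / 2), (1 - t) / 2, t / 2⟩ := by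
    ext <;> simp <;> ring
  have h3 : icosian t 0 1 (-1 + t) 0 = ⟨0, 1 / 2, -((1 - t) / 2), t / 2⟩ := by
    ext <;> simp <;> ring
  have h4 : icosian t 0 1 0 (-t) = ⟨0, 1 / 2, (1 - t) / 2, -(t / 2)⟩ := by
    ext <;> simp <;> ring
  rw [h1, h2, h3, h4]
  rfl

lemma isIcosian_of_mem_CQ {c : Quaternion ℝ} (hc : c ∈ CQ t) : IsIcosian t c := by
  rw [mem_CQ_iff] at hc
  rcases hc with rfl | rfl | rfl | rfl <;> exact ⟨_, _, _, _, rfl⟩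

lemma not_isHurwitz_of_mem_CQ {c : Quaternion ℝ} (hc : c ∈ CQ t) : ¬ IsHurwitz c := by
  rw [mem_CQ_iff] at hc
  rcases hc with rfl | rfl | rfl | rfl <;> rw [isHurwitz_icosian_iff] <;>
    simpa using not_two_dvd_one

lemma star_of_mem_CQ {c : Quaternion ℝ} (hc : c ∈ CQ t) : star c = -c := by
  rw [mem_CQ_iff] at hc
  rw [Quaternion.star_eq_neg]
  rcases hc with rfl | rfl | rfl | rfl <;> simp

lemma normSq_of_mem_CQ (ht : IsRoot t) {c : Quaternion ℝ} (hc : c ∈ CQ t) :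
    Quaternion.normSq c = 1 := by
  rw [mem_CQ_iff] at hc
  rcases hc with rfl | rfl | rfl | rfl <;> rw [normSq_icosian ht] <;> push_cast <;> ring

lemma mul_self_of_mem_CQ (ht : IsRoot t) {c : Quaternion ℝ} (hc : c ∈ CQ t) :
    c * c = -1 := by
  have h := Quaternion.self_mul_star c
  rw [star_of_mem_CQ hc, normSq_of_mem_CQ ht hc, mul_neg] at h
  rw [← neg_neg (c * c), h, Quaternion.coe_one]

/-- Which of the products of an icosian with the four letters lie in the Hurwitz order. -/
lemma isHurwitz_icosian_mul_letter (ht : IsRoot t) (s₀ s₁ s₂ s₃ : goldenInt) :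
    (IsHurwitz (icosian t s₀ s₁ s₂ s₃ * icosian t 0 1 0 0) ↔
      2 ∣ (1 + t) * s₀ + s₂ + s₃) ∧
    (IsHurwitz (icosian t s₀ s₁ s₂ s₃ * icosian t 0 (-1) (1 - t) t) ↔
      2 ∣ (1 + t) * s₀ + s₂ + s₃ + s₁) ∧
    (IsHurwitz (icosian t s₀ s₁ s₂ s₃ * icosian t 0 1 (-1 + t) 0) ↔
      2 ∣ (1 + t) * s₀ + s₂ + s₃ + (1 + t) * s₁) ∧
    (IsHurwitz (icosian t s₀ s₁ s₂ s₃ * icosian t 0 1 0 (-t)) ↔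
      2 ∣ (1 + t) * s₀ + s₂ + s₃ + t * s₁) := by
  have h := ht.mul_self
  simp only [icosian_mul ht, isHurwitz_icosian_iff]
  clear ht
  refine ⟨dvd_iff_dvd_of_dvd_sub ⟨s₁ + (-1 + t) * s₃, ?_⟩,
    dvd_iff_dvd_of_dvd_sub ⟨-s₀ + (-1 + t) * s₃, ?_⟩,
    dvd_iff_dvd_of_dvd_sub ⟨-s₁ + (-1 + t) * s₂, ?_⟩,
    dvd_iff_dvd_of_dvd_sub ⟨-t * s₀ + (1 - t) * s₁ - t * s₂ - s₃, ?_⟩⟩ <;> grind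

lemma goldenInt.IsRoot.two_dvd_iff (ht : IsRoot t) (a b : ℤ) :
    (2 : goldenInt) ∣ a + b * t ↔ 2 ∣ a ∧ 2 ∣ b := by
  rcases ht with rfl | rfl
  · exact goldenInt.two_dvd_iff a b
  · rw [show (a : goldenInt) + b * (1 - tau) = (a + b : ℤ) + (-b : ℤ) * tau by push_cast; ring,
      goldenInt.two_dvd_iff]
    omega

lemma eq_of_isHurwitz_mul (ht : IsRoot t) {a b : Quaternion ℝ} (ha : a ∈ CQ t)
    (hb : b ∈ CQ t) (h : IsHurwitz (a * b)) : a = b := by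
  have odd (m n : ℤ) (hmn : ¬ (2 ∣ m ∧ 2 ∣ n)) : ¬ (2 : goldenInt) ∣ m + n * t :=
    fun h ↦ hmn ((ht.two_dvd_iff m n).1 h)
  rw [mem_CQ_iff] at ha hb
  rcases ha with rfl | rfl | rfl | rfl <;> rcases hb with rfl | rfl | rfl | rfl
  all_goals first
    | rfl
    | exfalso
      simp only [isHurwitz_icosian_mul_letter ht] at h
      ring_nf at h
      first
        | exact odd 1 0 (by decide) (by simpa using h)
        | exact odd 0 1 (by decide) (by simpa using h)
        | exact odd 1 1 (by decide) (by simpa using h)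
        | exact odd 1 (-1) (by decide) (by simpa [← sub_eq_add_neg] using h)
        | exact odd (-1) 1 (by decide) (by simpa using h)
        | exact odd (-1) 2 (by decide) (by simpa [mul_comm] using h)

/-- A property, in terms of `2`-adic denominators, of the products of alternating words whose
first letter is in `CQ t`. -/
def IsLeading (t : goldenInt) (x : Quaternion ℝ) : Prop :=
  (∃ (k : ℕ) (s₀ s₁ s₂ s₃ : goldenInt), ((2 : ℝ) ^ k) • x = icosian t s₀ s₁ s₂ s₃ ∧ ¬ 2 ∣ s₁) ∨
  ∃ (k : ℕ) (h₀ h₁ h₂ h₃ : goldenInt), ((2 : ℝ) ^ (k + 1)) • x = hurwitz h₀ h₁ h₂ h₃ ∧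
    ¬ 2 ∣ (1 - t) * h₀ + h₁ + h₂ + h₃

lemma pow_smul_hurwitz (k : ℕ) (h₀ h₁ h₂ h₃ : goldenInt) :
    ((2 : ℝ) ^ k) • hurwitz h₀ h₁ h₂ h₃ =
      hurwitz (2 ^ k * h₀) (2 ^ k * h₁) (2 ^ k * h₂) (2 ^ k * h₃) := by
  ext <;> simp <;> ring

lemma isLeading_of_isIcosian {x : Quaternion ℝ} (hx : IsIcosian t x) (hx' : ¬ IsHurwitz x) :
    IsLeading t x := by
  obtain ⟨s₀, s₁, s₂, s₃, rfl⟩ := hx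
  exact Or.inl ⟨0, s₀, s₁, s₂, s₃, by simp, by rwa [isHurwitz_icosian_iff] at hx'⟩

lemma IsLeading.not_isHurwitz {x : Quaternion ℝ} (hx : IsLeading t x) : ¬ IsHurwitz x := by
  rintro ⟨h₀, h₁, h₂, h₃, rfl⟩
  rcases hx with ⟨k, s₀, s₁, s₂, s₃, h, hs⟩ | ⟨k, r₀, r₁, r₂, r₃, h, hr⟩
  · rw [pow_smul_hurwitz] at h
    refine hs (isHurwitz_icosian_iff.1 ⟨_, _, _, _, h.symm⟩)
  · rw [pow_smul_hurwitz] at h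
    obtain ⟨rfl, rfl, rfl, rfl⟩ := hurwitz_injective h
    exact hr ⟨2 ^ k * ((1 - t) * h₀ + h₁ + h₂ + h₃), by ring⟩

lemma not_two_dvd_of_dvd_sub {x y : goldenInt} (h : 2 ∣ x - y) (hy : ¬ 2 ∣ y) : ¬ 2 ∣ x :=
  fun hx ↦ hy ((dvd_iff_dvd_of_dvd_sub h).1 hx)

lemma not_two_dvd_mul {x y : goldenInt} (hx : ¬ 2 ∣ x) (hy : ¬ 2 ∣ y) : ¬ 2 ∣ x * y :=
  fun h ↦ (two_dvd_or_of_mul h).elim hx hy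

lemma IsLeading.mul (ht : IsRoot t) {g x : Quaternion ℝ} (hg : IsIcosian t g)
    (hg' : ¬ IsHurwitz g) (hx : IsLeading (1 - t) x) : IsLeading t (g * x) := by
  obtain ⟨r₀, r₁, r₂, r₃, rfl⟩ := hg
  rw [isHurwitz_icosian_iff] at hg'
  rcases hx with ⟨k, s₀, s₁, s₂, s₃, h, hs⟩ | ⟨k, h₀, h₁, h₂, h₃, h, hh⟩
  · obtain ⟨h₀, h₁, h₂, h₃, e, hd⟩ := smul_icosian_one_sub_mul ht.one_sub r₀ r₁ r₂ r₃ s₀ s₁ s₂ s₃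
    rw [sub_sub_cancel] at e
    refine Or.inr ⟨k, h₀, h₁, h₂, h₃, ?_, not_two_dvd_of_dvd_sub hd (not_two_dvd_mul hg' hs)⟩
    rw [← e, ← h, mul_smul_comm, smul_smul, pow_succ']
  · obtain ⟨s₀, s₁, s₂, s₃, e, hd⟩ := icosian_mul_hurwitz ht r₀ r₁ r₂ r₃ h₀ h₁ h₂ h₃
    rw [sub_sub_cancel] at hh
    refine Or.inl ⟨k + 1, s₀, s₁, s₂, s₃, ?_,
      not_two_dvd_of_dvd_sub hd (not_two_dvd_mul hg' hh)⟩
    rw [← e, ← h, mul_smul_comm]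

/-- Words alternating between `CQ t` and `CQ (1 - t)` which are empty or start in `CQ t`. -/
def Alternating : goldenInt → List (Quaternion ℝ) → Prop
  | _, [] => True
  | t, a :: l => a ∈ CQ t ∧ Alternating (1 - t) l

lemma Alternating.isLeading_mul_prod (ht : IsRoot t) {g : Quaternion ℝ} (hg : IsIcosian t g)
    (hg' : ¬ IsHurwitz g) {l : List (Quaternion ℝ)} (hl : Alternating (1 - t) l) :
    IsLeading t (g * l.prod) := by
  induction l generalizing t g with
  | nil => simpa using isLeading_of_isIcosian hg hg'
  | cons a l ih =>
    rw [List.prod_cons]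
    exact (ih ht.one_sub (isIcosian_of_mem_CQ hl.1) (not_isHurwitz_of_mem_CQ hl.1) hl.2).mul
      ht hg hg'

lemma isHurwitz_one : IsHurwitz 1 := ⟨2, -1, -1, -1, by
  ext <;> simp [Quaternion.re_one, Quaternion.imI_one, Quaternion.imJ_one, Quaternion.imK_one]⟩

lemma IsHurwitz.neg {x : Quaternion ℝ} (hx : IsHurwitz x) : IsHurwitz (-x) := by
  obtain ⟨h₀, h₁, h₂, h₃, rfl⟩ := hx
  exact ⟨-h₀, -h₁, -h₂, -h₃, by ext <;> simp <;> ring⟩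

lemma IsIcosian.neg {x : Quaternion ℝ} (hx : IsIcosian t x) : IsIcosian t (-x) := by
  obtain ⟨s₀, s₁, s₂, s₃, rfl⟩ := hx
  exact ⟨-s₀, -s₁, -s₂, -s₃, by ext <;> simp <;> ring⟩

lemma neg_mul_cancel_of_mem_CQ (ht : IsRoot t) {c : Quaternion ℝ} (hc : c ∈ CQ t)
    (x : Quaternion ℝ) : -c * (c * x) = x := by
  rw [← mul_assoc, neg_mul, mul_self_of_mem_CQ ht hc, neg_neg, one_mul]

lemma IsLeading.ne_prod (ht : IsRoot t) {x : Quaternion ℝ} (hx : IsLeading t x)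
    {l : List (Quaternion ℝ)} (hl : Alternating (1 - t) l) : x ≠ l.prod := by
  induction l generalizing t x with
  | nil =>
    rintro rfl
    exact hx.not_isHurwitz isHurwitz_one
  | cons b l ih =>
    rintro rfl
    have hb := hl.1
    have hx' : IsLeading (1 - (1 - t)) (b :: l).prod := by rwa [sub_sub_cancel]
    refine ih ht.one_sub (hx'.mul ht.one_sub (isIcosian_of_mem_CQ hb).neg
      fun h ↦ not_isHurwitz_of_mem_CQ hb ?_) hl.2 ?_
    · simpa using h.neg
    · rw [List.prod_cons, neg_mul_cancel_of_mem_CQ ht.one_sub hb]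

lemma star_mul_self_of_normSq {x : Quaternion ℝ} (hx : Quaternion.normSq x = 1) :
    star x * x = 1 := by
  rw [Quaternion.star_mul_self, hx, Quaternion.coe_one]

lemma Alternating.eq_nil_of_isHurwitz_prod {l : List (Quaternion ℝ)} (ht : IsRoot t)
    (hl : Alternating t l) (h : IsHurwitz l.prod) : l = [] := by
  cases l with
  | nil => rfl
  | cons a l =>
    rw [List.prod_cons] at h
    exact absurd h (hl.2.isLeading_mul_prod ht (isIcosian_of_mem_CQ hl.1)
      (not_isHurwitz_of_mem_CQ hl.1)).not_isHurwitz

lemma Alternating.prod_ne_zero {l : List (Quaternion ℝ)} (ht : IsRoot t)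
    (hl : Alternating t l) : l.prod ≠ 0 := by
  induction l generalizing t with
  | nil => simp
  | cons a l ih =>
    rw [List.prod_cons]
    refine mul_ne_zero (fun ha ↦ ?_) (ih ht.one_sub hl.2)
    simpa [ha] using normSq_of_mem_CQ ht hl.1

lemma eq_of_mul_prod_eq {u : goldenInt} (ht : IsRoot t) (hu : IsRoot u) {w : Quaternion ℝ}
    (hw : IsHurwitz w) (hw' : Quaternion.normSq w = 1) {l₁ l₂ : List (Quaternion ℝ)}
    (h₁ : Alternating t l₁) (h₂ : Alternating u l₂) (h : w * l₁.prod = l₂.prod) : l₁ = l₂ := by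
  induction l₁ generalizing t u w l₂ with
  | nil =>
    rw [List.prod_nil, mul_one] at h
    exact (h₂.eq_nil_of_isHurwitz_prod hu (h ▸ hw)).symm
  | cons a l₁ ih =>
    cases l₂ with
    | nil =>
      refine h₁.eq_nil_of_isHurwitz_prod ht ?_
      rw [← one_mul (List.prod _), ← star_mul_self_of_normSq hw', mul_assoc, h, List.prod_nil,
        mul_one]
      exact hw.star
    | cons b l₂ =>
      have ha := h₁.1
      have hb := h₂.1
      rw [List.prod_cons, ← mul_assoc] at h
      rcases hu.eq_or_eq_one_sub ht with rfl | rfl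
      · rw [List.prod_cons] at h
        have h' : -b * (w * a) * l₁.prod = l₂.prod := by
          rw [mul_assoc, h, neg_mul_cancel_of_mem_CQ ht hb]
        by_cases hg : IsHurwitz (-b * (w * a))
        · obtain rfl := ih ht.one_sub ht.one_sub hg (by
            simp [normSq_of_mem_CQ ht ha, normSq_of_mem_CQ ht hb, hw']) h₁.2 h₂.2 h'
          have hwa : w * a = b := mul_right_cancel₀ (h₁.2.prod_ne_zero ht.one_sub) h
          rw [eq_of_isHurwitz_mul ht hb ha]
          rw [← hwa, mul_assoc, mul_self_of_mem_CQ ht ha, mul_neg_one]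
          exact hw.neg
        · refine absurd h' (IsLeading.ne_prod ht ?_ h₂.2)
          exact h₁.2.isLeading_mul_prod ht ((isIcosian_of_mem_CQ hb).neg.mul ht
            ((hw.isIcosian _).mul ht (isIcosian_of_mem_CQ ha))) hg
      · refine absurd h (IsLeading.ne_prod ht ?_ h₂)
        refine h₁.2.isLeading_mul_prod ht ((hw.isIcosian _).mul ht (isIcosian_of_mem_CQ ha)) ?_
        intro hwa
        refine not_isHurwitz_of_mem_CQ ha ?_
        rw [← one_mul a, ← star_mul_self_of_normSq hw', mul_assoc]
        exact hw.star.mul hwa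

lemma isIcosian_mk {x : Quaternion ℝ} {a b c d : goldenInt} (ha : x.re = a / 2)
    (hb : x.imI = b / 2) (hc : x.imJ = c / 2) (hd : x.imK = d / 2)
    (hJ : 2 ∣ c - a - (b - a) * (1 - t)) (hK : 2 ∣ d - a - (b - a) * t) : IsIcosian t x := by
  obtain ⟨m, hm⟩ := hJ
  obtain ⟨n, hn⟩ := hK
  have hm' : (c - a - (b - a) * (1 - t) : ℝ) = 2 * m := by exact_mod_cast congrArg Subtype.val hm
  have hn' : (d - a - (b - a) * t : ℝ) = 2 * n := by exact_mod_cast congrArg Subtype.val hn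
  refine ⟨a, b - a, m, n, ?_⟩
  ext <;> simp only [icosian_re, icosian_imI, icosian_imJ, icosian_imK, ha, hb, hc, hd] <;>
    push_cast
  · ring
  · linear_combination hm' / 2
  · linear_combination hn' / 2

lemma isHurwitz_mk {x : Quaternion ℝ} {d a b c e : goldenInt} (ha : x.re = d / 2 + a)
    (hb : x.imI = d / 2 + b) (hc : x.imJ = d / 2 + c) (he : x.imK = d / 2 + e) :
    IsHurwitz x := by
  refine ⟨d + 2 * a, b - a, c - a, e - a, ?_⟩
  ext <;> simp only [hurwitz_re, hurwitz_imI, hurwitz_imJ, hurwitz_imK, ha, hb, hc, he] <;>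
    push_cast <;> ring

lemma normSq_toQ (x : Fin 4 → ℝ) : Quaternion.normSq (toQ x) = ∑ i, x i ^ 2 := by
  rw [Quaternion.normSq_def', Fin.sum_univ_four]
  rfl

lemma normSq_toQ_of_mem_DeltaSet (ht : IsRoot t) {x : Fin 4 → ℝ} (hx : x ∈ DeltaSet t) :
    Quaternion.normSq (toQ x) = 1 := by
  rw [normSq_toQ]
  rcases hx with ⟨i, hi, h⟩ | h | ⟨σ, -, ε, hε, h⟩
  · rw [Finset.sum_eq_single i (fun j _ hj ↦ by rw [h j hj]; norm_num) (by simp)]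
    rcases hi with hi | hi <;> rw [hi] <;> norm_num
  · rw [Finset.sum_congr rfl fun i _ ↦ show x i ^ 2 = 1 / 4 by
      rcases h i with hi | hi <;> rw [hi] <;> norm_num]
    norm_num
  · rw [Finset.sum_congr rfl fun i _ ↦
      show x i ^ 2 = (![0, 1, 1 - (t : ℝ), t] (σ i)) ^ 2 / 4 by
        rw [h i]; rcases hε i with hi | hi <;> rw [hi] <;> ring,
      Equiv.sum_comp σ (fun i ↦ (![0, 1, 1 - (t : ℝ), t] i) ^ 2 / 4), Fin.sum_univ_four]
    simp
    linear_combination ht.coe_mul_self / 2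

lemma even_perm_values (σ : Equiv.Perm (Fin 4)) (hσ : Equiv.Perm.sign σ = 1) :
    (σ 0, σ 1, σ 2, σ 3) ∈ [(0, 1, 2, 3), (0, 2, 3, 1), (0, 3, 1, 2), (1, 0, 3, 2),
      (1, 2, 0, 3), (1, 3, 2, 0), (2, 0, 1, 3), (2, 1, 3, 0), (2, 3, 0, 1), (3, 0, 2, 1),
      (3, 1, 0, 2), ((3 : Fin 4), (2 : Fin 4), (1 : Fin 4), (0 : Fin 4))] := by
  revert σ
  decide

lemma two_dvd_of_even_perm (ht : IsRoot t) (σ : Equiv.Perm (Fin 4))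
    (hσ : Equiv.Perm.sign σ = 1) :
    let v := ![0, 1, 1 - t, t]
    2 ∣ v (σ 2) - v (σ 0) - (v (σ 1) - v (σ 0)) * (1 - t) ∧
      2 ∣ v (σ 3) - v (σ 0) - (v (σ 1) - v (σ 0)) * t := by
  have h := even_perm_values σ hσ
  have hsq : t ^ 2 = t + 1 := by rw [sq, ht.mul_self]
  simp only [List.mem_cons, Prod.mk.injEq, List.not_mem_nil, or_false] at h
  rcases h with h | h | h | h | h | h | h | h | h | h | h | h <;>
    obtain ⟨h₀, h₁, h₂, h₃⟩ := h <;> simp only [h₀, h₁, h₂, h₃] <;>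
    simp <;> constructor <;> ring_nf <;> (try simp only [hsq]) <;> ring_nf
  all_goals first
    | exact dvd_zero _
    | exact ⟨1, by ring1⟩
    | exact ⟨-1, by ring1⟩
    | exact ⟨t, by ring1⟩
    | exact ⟨-t, by ring1⟩
    | exact ⟨1 - t, by ring1⟩
    | exact ⟨t - 1, by ring1⟩

lemma isIcosian_toQ (ht : IsRoot t) {x : Fin 4 → ℝ} (hx : x ∈ DeltaSet t) :
    IsIcosian t (toQ x) := by
  rcases hx with ⟨i, hi, h⟩ | h | ⟨σ, hσ, ε, hε, h⟩
  · have hx (j) : ∃ a : goldenInt, x j = (0 : goldenInt) / 2 + a := by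
      by_cases hj : j = i
      · subst hj
        rcases hi with hi | hi
        · exact ⟨1, by simp [hi]⟩
        · exact ⟨-1, by simp [hi]⟩
      · exact ⟨0, by simp [h j hj]⟩
    choose a ha using hx
    exact (isHurwitz_mk (ha 0) (ha 1) (ha 2) (ha 3)).isIcosian t
  · have hx (j) : ∃ a : goldenInt, x j = (1 : goldenInt) / 2 + a := by
      rcases h j with hj | hj
      · exact ⟨0, by simp [hj]⟩
      · exact ⟨-1, by rw [hj]; push_cast; norm_num⟩
    choose a ha using hx
    exact (isHurwitz_mk (ha 0) (ha 1) (ha 2) (ha 3)).isIcosian t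
  · have hx (j) : ∃ δ : goldenInt, x j =
        ((1 + 2 * δ) * ![0, 1, 1 - t, t] (σ j) : goldenInt) / 2 := by
      have hv (i) : ((![0, 1, 1 - t, t] i : goldenInt) : ℝ) = ![0, 1, 1 - (t : ℝ), t] i := by
        fin_cases i <;> simp
      rcases hε j with hj | hj
      · exact ⟨0, by rw [h j, hj]; push_cast; rw [hv]; ring⟩
      · exact ⟨-1, by rw [h j, hj]; push_cast; rw [hv]; ring⟩
    choose δ hδ using hx
    obtain ⟨⟨m, hm⟩, n, hn⟩ := two_dvd_of_even_perm ht σ hσ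
    set v := ![0, 1, 1 - t, t]
    exact isIcosian_mk (hδ 0) (hδ 1) (hδ 2) (hδ 3)
      ⟨m + δ 2 * v (σ 2) - δ 0 * v (σ 0) - (δ 1 * v (σ 1) - δ 0 * v (σ 0)) * (1 - t),
        by linear_combination hm⟩
      ⟨n + δ 3 * v (σ 3) - δ 0 * v (σ 0) - (δ 1 * v (σ 1) - δ 0 * v (σ 0)) * t,
        by linear_combination hn⟩

lemma sum_sq_of_parity {a : Fin 4 → ℤ} (ha : ∀ i, 2 ∣ a i - a 0) (h0 : a ≠ 0) :
    4 ≤ ∑ i, a i ^ 2 := by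
  rcases Int.even_or_odd (a 0) with h | h
  · obtain ⟨i, hi⟩ := Function.ne_iff.1 h0
    refine le_trans ?_ (Finset.single_le_sum (fun j _ ↦ sq_nonneg (a j)) (Finset.mem_univ i))
    obtain ⟨c, hc⟩ : 2 ∣ a i := by have := ha i; have := h.two_dvd; omega
    have hc0 : c ≠ 0 := by rintro rfl; exact hi hc
    rw [hc]
    nlinarith [sq_pos_of_ne_zero hc0]
  · have h1 (i) : 1 ≤ a i ^ 2 := by
      have hi : a i ≠ 0 := by
        have := ha i
        obtain ⟨c, hc⟩ := h
        omega
      have := sq_pos_of_ne_zero hi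
      omega
    simpa using Finset.sum_le_sum fun i (_ : i ∈ Finset.univ) ↦ h1 i

lemma eq_of_sum_sq_eq_four {a : Fin 4 → ℤ} (ha : ∀ i, 2 ∣ a i - a 0)
    (h : ∑ i, a i ^ 2 = 4) :
    (∃ i, (a i = 2 ∨ a i = -2) ∧ ∀ j, j ≠ i → a j = 0) ∨ ∀ i, a i = 1 ∨ a i = -1 := by
  rcases Int.even_or_odd (a 0) with h0 | h0
  · left
    have ha' (i) : 2 ∣ a i := by have := ha i; have := h0.two_dvd; omega
    obtain ⟨i, hi⟩ : ∃ i, a i ≠ 0 := by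
      by_contra! hz
      simp [hz] at h
    have hi4 : 4 ≤ a i ^ 2 := by
      obtain ⟨c, hc⟩ := ha' i
      have hc0 : c ≠ 0 := by rintro rfl; exact hi hc
      rw [hc]
      nlinarith [sq_pos_of_ne_zero hc0]
    rw [← Finset.add_sum_erase _ _ (Finset.mem_univ i)] at h
    have hs : 0 ≤ ∑ j ∈ Finset.univ.erase i, a j ^ 2 := Finset.sum_nonneg fun j _ ↦ sq_nonneg _
    refine ⟨i, ?_, fun j hj ↦ ?_⟩
    · exact sq_eq_sq_iff_eq_or_eq_neg.1 (by linarith)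
    · have hs0 : ∑ j ∈ Finset.univ.erase i, a j ^ 2 = 0 := by linarith
      rw [Finset.sum_eq_zero_iff_of_nonneg fun j _ ↦ sq_nonneg _] at hs0
      simpa using hs0 j (by simp [hj])
  · right
    have h1 (i) : 0 ≤ a i ^ 2 - 1 := by
      have hi : a i ≠ 0 := by
        have := ha i
        obtain ⟨c, hc⟩ := h0
        omega
      have := sq_pos_of_ne_zero hi
      omega
    have hs : ∑ i, (a i ^ 2 - 1) = 0 := by
      rw [Finset.sum_sub_distrib, h]
      simp
    rw [Finset.sum_eq_zero_iff_of_nonneg fun i _ ↦ h1 i] at hs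
    intro i
    have := hs i (Finset.mem_univ i)
    exact sq_eq_sq_iff_eq_or_eq_neg.1 (by linarith)

lemma toQ_mem_KQ_of_sq {x : Fin 4 → ℝ} {a b : Fin 4 → ℤ} (ha : ∀ i, 2 ∣ a i - a 0)
    (hb : ∀ i, 2 ∣ b i - b 0) (hx : ∀ i, x i = ((a i : goldenInt) + b i * tau : goldenInt) / 2)
    (h : ∑ i, x i ^ 2 = 1) : toQ x ∈ KQ := by
  have hab : ((∑ i, (a i ^ 2 + b i ^ 2) : ℤ) : goldenInt) +
      (∑ i, (2 * a i * b i + b i ^ 2) : ℤ) * tau = (4 : ℤ) + (0 : ℤ) * tau := by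
    refine Subtype.ext ?_
    simp only [hx] at h
    push_cast at h ⊢
    simp only [Fin.sum_univ_four, coe_tau] at h ⊢
    linear_combination 4 * h - (b 0 ^ 2 + b 1 ^ 2 + b 2 ^ 2 + b 3 ^ 2 : ℝ) * gr_mul_self
  obtain ⟨h1, h2⟩ := add_mul_tau_inj hab
  rw [Finset.sum_add_distrib] at h1 h2
  have hb0 : b = 0 := by
    by_contra hb0
    have hb4 := sum_sq_of_parity hb hb0
    have ha0 : ∑ i, a i ^ 2 = 0 :=
      le_antisymm (by linarith) (Finset.sum_nonneg fun i _ ↦ sq_nonneg _)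
    rw [Finset.sum_eq_zero_iff_of_nonneg fun i _ ↦ sq_nonneg _] at ha0
    have ha0' (i) : a i = 0 := by simpa using ha0 i (Finset.mem_univ i)
    simp only [ha0'] at h2
    simp at h2
    linarith
  subst hb0
  replace hx (i) : x i = a i / 2 := by rw [hx]; simp
  have hD (s : ℝ) : x ∈ DeltaSet s := by
    rcases eq_of_sum_sq_eq_four ha (by simpa using h1) with ⟨i, hi, h0⟩ | h0
    · refine Or.inl ⟨i, ?_, fun j hj ↦ by rw [hx, h0 j hj]; simp⟩
      rw [hx]
      rcases hi with hi | hi <;> rw [hi] <;> norm_num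
    · refine Or.inr (Or.inl fun i ↦ ?_)
      rw [hx]
      rcases h0 i with hi | hi <;> rw [hi] <;> norm_num
  exact ⟨x, ⟨hD _, hD _⟩, rfl⟩

lemma mem_KQ_iff {x : Quaternion ℝ} : x ∈ KQ ↔ IsHurwitz x ∧ Quaternion.normSq x = 1 := by
  constructor
  · rintro ⟨x, ⟨hx, hx'⟩, rfl⟩
    have h' : x ∈ DeltaSet (1 - tau : goldenInt) := by simpa using hx'
    exact ⟨isHurwitz_of_isIcosian isRoot_tau (isIcosian_toQ isRoot_tau hx)
      (isIcosian_toQ isRoot_tau.one_sub h'), normSq_toQ_of_mem_DeltaSet isRoot_tau hx⟩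
  · rintro ⟨⟨h₀, h₁, h₂, h₃, rfl⟩, hx⟩
    obtain ⟨a₀, b₀, rfl⟩ := exists_eq h₀
    obtain ⟨a₁, b₁, rfl⟩ := exists_eq h₁
    obtain ⟨a₂, b₂, rfl⟩ := exists_eq h₂
    obtain ⟨a₃, b₃, rfl⟩ := exists_eq h₃
    set y := hurwitz (a₀ + b₀ * tau) (a₁ + b₁ * tau) (a₂ + b₂ * tau) (a₃ + b₃ * tau) with hy
    have hyx : y = toQ ![y.re, y.imI, y.imJ, y.imK] := rfl
    rw [hyx, normSq_toQ] at hx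
    rw [hyx]
    refine toQ_mem_KQ_of_sq (a := ![a₀, a₀ + 2 * a₁, a₀ + 2 * a₂, a₀ + 2 * a₃])
      (b := ![b₀, b₀ + 2 * b₁, b₀ + 2 * b₂, b₀ + 2 * b₃]) ?_ ?_ ?_ hx
    · intro i
      fin_cases i <;> simp
    · intro i
      fin_cases i <;> simp
    · intro i
      fin_cases i <;> simp [hy] <;> ring

lemma exists_isHurwitz_mul (ht : IsRoot t) {x : Quaternion ℝ} (hx : IsIcosian t x) :
    IsHurwitz x ∨ ∃ c ∈ CQ t, IsHurwitz (x * c) := by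
  obtain ⟨s₀, s₁, s₂, s₃, rfl⟩ := hx
  obtain ⟨e₁, e₂, e₃, e₄⟩ := isHurwitz_icosian_mul_letter ht s₀ s₁ s₂ s₃
  rcases ht.two_dvd_projective ((1 + t) * s₀ + s₂ + s₃) s₁ with h | h | h | h | h
  · exact Or.inl (isHurwitz_icosian_iff.2 h)
  · exact Or.inr ⟨_, mem_CQ_iff.2 (Or.inl rfl), e₁.2 h⟩
  · exact Or.inr ⟨_, mem_CQ_iff.2 (Or.inr (Or.inl rfl)), e₂.2 h⟩
  · exact Or.inr ⟨_, mem_CQ_iff.2 (Or.inr (Or.inr (Or.inr rfl))), e₄.2 h⟩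
  · refine Or.inr ⟨_, mem_CQ_iff.2 (Or.inr (Or.inr (Or.inl rfl))), e₃.2 ?_⟩
    exact (dvd_iff_dvd_of_dvd_sub ⟨t * s₁, by ring⟩).2 h

/-- Existence of an expression as an element of `K` times an alternating word. -/
def HasNormalForm (x : Quaternion ℝ) : Prop :=
  ∃ t w l, IsRoot t ∧ IsHurwitz w ∧ Quaternion.normSq w = 1 ∧ Alternating t l ∧ x = w * l.prod

lemma hasNormalForm_mul_prod (ht : IsRoot t) {g : Quaternion ℝ} (hg : IsIcosian t g)
    (hg' : Quaternion.normSq g = 1) {l : List (Quaternion ℝ)} (hl : Alternating (1 - t) l) :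
    HasNormalForm (g * l.prod) := by
  rcases exists_isHurwitz_mul ht hg with h | ⟨c, hc, h⟩
  · exact ⟨1 - t, g, l, ht.one_sub, h, hg', hl, rfl⟩
  · refine ⟨t, -(g * c), c :: l, ht, h.neg, ?_, ⟨hc, hl⟩, ?_⟩
    · simp [hg', normSq_of_mem_CQ ht hc]
    · rw [List.prod_cons, ← mul_assoc, neg_mul, mul_assoc g, mul_self_of_mem_CQ ht hc,
        mul_neg_one, neg_neg]

lemma HasNormalForm.mul (ht : IsRoot t) {g x : Quaternion ℝ} (hg : IsIcosian t g)
    (hg' : Quaternion.normSq g = 1) (hx : HasNormalForm x) : HasNormalForm (g * x) := by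
  obtain ⟨u, w, l, hu, hw, hw', hl, rfl⟩ := hx
  have hgw : IsIcosian t (g * w) := hg.mul ht (hw.isIcosian t)
  have hgw' : Quaternion.normSq (g * w) = 1 := by simp [hg', hw']
  rw [← mul_assoc]
  rcases hu.eq_or_eq_one_sub ht with rfl | rfl
  · cases l with
    | nil => exact hasNormalForm_mul_prod hu (l := []) hgw hgw' trivial
    | cons a l =>
      rw [List.prod_cons, ← mul_assoc]
      exact hasNormalForm_mul_prod hu (hgw.mul hu (isIcosian_of_mem_CQ hl.1))
        (by rw [map_mul, hgw', normSq_of_mem_CQ hu hl.1, one_mul]) hl.2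
  · exact hasNormalForm_mul_prod ht hgw hgw' hl

lemma two_dvd_or_exists_mul_hurwitz_eq (ht : IsRoot t) {h₀ h₁ h₂ h₃ : goldenInt}
    (hφ : 2 ∣ t * h₀ + h₁ + h₂ + h₃) :
    2 ∣ h₀ ∨ ∃ c ∈ CQ t, ∃ r₀ r₁ r₂ r₃, c * hurwitz h₀ h₁ h₂ h₃ =
      hurwitz (2 * r₀) r₁ r₂ r₃ := by
  have hsq := ht.mul_self
  have key {c₁ c₂ c₃ : goldenInt} (m : goldenInt)
      (hc : icosian t 0 c₁ c₂ c₃ ∈ CQ t)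
      (h : ∃ s₀ s₁ s₂ s₃, icosian t 0 c₁ c₂ c₃ * hurwitz h₀ h₁ h₂ h₃ = icosian t s₀ s₁ s₂ s₃ ∧
        2 ∣ s₀ - m ∧ 2 ∣ s₁ - (t * h₀ + h₁ + h₂ + h₃)) (hm : 2 ∣ m) :
      ∃ c ∈ CQ t, ∃ r₀ r₁ r₂ r₃, c * hurwitz h₀ h₁ h₂ h₃ = hurwitz (2 * r₀) r₁ r₂ r₃ := by
    obtain ⟨s₀, s₁, s₂, s₃, e, hs₀, hs₁⟩ := h
    obtain ⟨a, rfl⟩ := (dvd_iff_dvd_of_dvd_sub hs₀).2 hm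
    obtain ⟨b, rfl⟩ := (dvd_iff_dvd_of_dvd_sub hs₁).2 hφ
    exact ⟨_, hc, _, _, _, _, e.trans (icosian_two_mul _ _ _ _ _)⟩
  rcases ht.two_dvd_projective (h₁ + (1 + t) * h₂ + t * h₃) h₀ with h | h | h | h | h
  · exact Or.inl h
  · refine Or.inr (key _ (mem_CQ_iff.2 (Or.inr (Or.inl rfl))) ?_ h)
    rw [hurwitz_eq_icosian t, icosian_mul ht]
    refine ⟨_, _, _, _, rfl, ⟨-h₂ - t * h₃, ?_⟩, ⟨-t * h₀ - h₁ - t * h₂, ?_⟩⟩ <;>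
      clear ht key <;> grind
  · refine Or.inr (key _ (mem_CQ_iff.2 (Or.inl rfl)) ?_ h)
    rw [hurwitz_eq_icosian t, icosian_mul ht]
    refine ⟨_, _, _, _, rfl, ⟨-h₀ - h₁ - h₂ - t * h₃, ?_⟩, ⟨(1 - t) * h₀ - t * h₂, ?_⟩⟩ <;>
      clear ht key <;> grind
  · refine Or.inr (key _ (mem_CQ_iff.2 (Or.inr (Or.inr (Or.inl rfl)))) ?_ h)
    rw [hurwitz_eq_icosian t, icosian_mul ht]
    refine ⟨_, _, _, _, rfl, ⟨-t * h₀ - h₁ - t * h₂ - t * h₃, ?_⟩, ⟨-h₂ + (-1 + t) * h₃, ?_⟩⟩ <;>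
      clear ht key <;> grind
  · refine Or.inr (key _ (mem_CQ_iff.2 (Or.inr (Or.inr (Or.inr rfl)))) ?_ h)
    rw [hurwitz_eq_icosian t, icosian_mul ht]
    refine ⟨_, _, _, _, rfl, ⟨-h₀ - h₁ - h₂ + t * h₀, ?_⟩, ⟨(1 - t) * h₀ - t * h₃, ?_⟩⟩ <;>
      clear ht key <;> grind

/-- Half of an integral quaternion with norm divisible by `4` is an icosian, for one of the two
roots. -/
lemma exists_isIcosian_half {x : Quaternion ℝ} {a b c d m : goldenInt} (ha : x.re = a / 2)
    (hb : x.imI = b / 2) (hc : x.imJ = c / 2) (hd : x.imK = d / 2)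
    (hm : a ^ 2 + b ^ 2 + c ^ 2 + d ^ 2 = 4 * m) : ∃ t, IsRoot t ∧ IsIcosian t x := by
  have hsq := tau_mul_self
  obtain ⟨k, hk⟩ : 2 ∣ a + b + c + d := by
    have : 2 ∣ (a + b + c + d) * (a + b + c + d) :=
      ⟨2 * m + a * b + a * c + a * d + b * c + b * d + c * d, by linear_combination hm⟩
    simpa using two_dvd_or_of_mul this
  have h2 : a * b + a * c + a * d + b * c + b * d + c * d = 2 * (k ^ 2 - m) := by
    have : (2 : goldenInt) * (a * b + a * c + a * d + b * c + b * d + c * d) =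
        2 * (2 * (k ^ 2 - m)) := by
      linear_combination (a + b + c + d + 2 * k) * hk - hm
    exact mul_left_cancel₀ two_ne_zero this
  have hd' : d = 2 * k - a - b - c := by linear_combination hk
  have hprod : 2 ∣ (c - a - (b - a) * (1 - tau)) * (c - a - (b - a) * tau) := by
    rw [hd'] at h2
    exact ⟨k * (a + b + c) - k ^ 2 + m - a ^ 2 - b ^ 2 - a * c - b * c + a * b,
      by linear_combination -h2 - (b - a) ^ 2 * hsq⟩
  have main {t : goldenInt} (ht : IsRoot t) (h : 2 ∣ c - a - (b - a) * (1 - t)) :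
      IsIcosian t x := by
    refine isIcosian_mk ha hb hc hd h ?_
    obtain ⟨n, hn⟩ := h
    exact ⟨k - a - b - n, by subst hd'; linear_combination -hn⟩
  rcases two_dvd_or_of_mul hprod with h | h
  · exact ⟨tau, isRoot_tau, main isRoot_tau h⟩
  · exact ⟨1 - tau, isRoot_tau.one_sub, main isRoot_tau.one_sub (by rwa [sub_sub_cancel])⟩

lemma one_half_pow_succ_smul (n : ℕ) (x : Quaternion ℝ) :
    ((1 / 2 : ℝ) ^ (n + 1)) • x = ((1 / 2 : ℝ) ^ n) • ((1 / 2 : ℝ) • x) := by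
  rw [smul_smul, pow_succ]

lemma coe_inj {x y : goldenInt} : (x : ℝ) = y ↔ x = y := Subtype.ext_iff.symm

lemma HasNormalForm.of_mul (ht : IsRoot t) {c x : Quaternion ℝ} (hc : c ∈ CQ t)
    (hx : HasNormalForm (c * x)) : HasNormalForm x := by
  rw [← neg_mul_cancel_of_mem_CQ ht hc x]
  exact HasNormalForm.mul ht (isIcosian_of_mem_CQ hc).neg (by simp [normSq_of_mem_CQ ht hc]) hx

lemma HasNormalForm.smul_mul (n : ℕ) (ht : IsRoot t) {x q : Quaternion ℝ} (hx : IsIcosian t x)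
    (hx' : Quaternion.normSq x = 4 ^ n) (hq : HasNormalForm q) :
    HasNormalForm (((1 / 2 : ℝ) ^ n) • x * q) := by
  induction n generalizing t x q with
  | zero => simpa using hq.mul ht hx (by simpa using hx')
  | succ n ih =>
    have even {h₀ h₁ h₂ h₃ : goldenInt}
        (hN : Quaternion.normSq (hurwitz (2 * h₀) h₁ h₂ h₃) = 4 ^ (n + 1)) {q : Quaternion ℝ}
        (hq : HasNormalForm q) :
        HasNormalForm (((1 / 2 : ℝ) ^ (n + 1)) • hurwitz (2 * h₀) h₁ h₂ h₃ * q) := by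
      rw [one_half_pow_succ_smul]
      set y := (1 / 2 : ℝ) • hurwitz (2 * h₀) h₁ h₂ h₃ with hy
      obtain ⟨u, hu, hyu⟩ : ∃ u, IsRoot u ∧ IsIcosian u y := by
        refine exists_isIcosian_half (a := h₀) (b := h₀ + h₁) (c := h₀ + h₂) (d := h₀ + h₃)
          (m := 4 ^ n) ?_ ?_ ?_ ?_ ?_
        · simp [hy]; ring
        · simp [hy]; ring
        · simp [hy]; ring
        · simp [hy]; ring
        · rw [normSq_hurwitz] at hN
          have hN' := coe_inj.1 (hN.trans (by push_cast; rfl :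
            _ = ((4 ^ (n + 1) : goldenInt) : ℝ)))
          linear_combination hN'
      refine ih hu hyu ?_ hq
      rw [hy, Quaternion.normSq_smul, hN]
      ring
    have hurw {h₀ h₁ h₂ h₃ : goldenInt}
        (hN : Quaternion.normSq (hurwitz h₀ h₁ h₂ h₃) = 4 ^ (n + 1)) {q : Quaternion ℝ}
        (hq : HasNormalForm q) :
        HasNormalForm (((1 / 2 : ℝ) ^ (n + 1)) • hurwitz h₀ h₁ h₂ h₃ * q) := by
      have main {u : goldenInt} (hu : IsRoot u) (hφ : 2 ∣ u * h₀ + h₁ + h₂ + h₃) :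
          HasNormalForm (((1 / 2 : ℝ) ^ (n + 1)) • hurwitz h₀ h₁ h₂ h₃ * q) := by
        rcases two_dvd_or_exists_mul_hurwitz_eq hu hφ with ⟨m, rfl⟩ | ⟨c, hc, r₀, r₁, r₂, r₃, e⟩
        · exact even hN hq
        · refine HasNormalForm.of_mul hu hc ?_
          rw [← mul_assoc, mul_smul_comm, e]
          exact even (by rw [← e, map_mul, normSq_of_mem_CQ hu hc, hN, one_mul]) hq
      have hφ : 2 ∣ (tau * h₀ + h₁ + h₂ + h₃) * ((1 - tau) * h₀ + h₁ + h₂ + h₃) := by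
        rw [normSq_hurwitz] at hN
        have hN' := coe_inj.1 (hN.trans (by push_cast; rfl :
          _ = ((4 ^ (n + 1) : goldenInt) : ℝ)))
        exact ⟨2 * 4 ^ n - h₀ ^ 2 + h₁ * h₂ + h₁ * h₃ + h₂ * h₃,
          by linear_combination hN' - h₀ ^ 2 * tau_mul_self⟩
      rcases two_dvd_or_of_mul hφ with h | h
      · exact main isRoot_tau h
      · exact main isRoot_tau.one_sub h
    rcases exists_isHurwitz_mul ht hx with h | ⟨c, hc, h⟩
    · obtain ⟨h₀, h₁, h₂, h₃, rfl⟩ := h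
      exact hurw hx' hq
    · have hxc : x * q = (x * c) * (-c * q) := by
        rw [mul_assoc, ← mul_assoc c, mul_neg, mul_self_of_mem_CQ ht hc, neg_neg, one_mul]
      have hN : Quaternion.normSq (x * c) = 4 ^ (n + 1) := by
        rw [map_mul, normSq_of_mem_CQ ht hc, hx', mul_one]
      obtain ⟨h₀, h₁, h₂, h₃, e⟩ := h
      rw [smul_mul_assoc, hxc, ← smul_mul_assoc, e]
      exact hurw (e ▸ hN) (hq.mul ht (isIcosian_of_mem_CQ hc).neg (by
        simp [normSq_of_mem_CQ ht hc]))

lemma hasNormalForm_one : HasNormalForm 1 :=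
  ⟨tau, 1, [], isRoot_tau, isHurwitz_one, by simp, trivial, by simp⟩

lemma exists_goldenInt_eq_div {x : ℝ} (hx : x ∈ Rgold) :
    ∃ n : ℕ, ∀ m ≥ n, ∃ y : goldenInt, x = (1 / 2) ^ m * y := by
  obtain ⟨a, b, n, rfl⟩ := hx
  refine ⟨n, fun m hm ↦ ⟨2 ^ (m - n) * (a + b * tau), ?_⟩⟩
  obtain ⟨k, rfl⟩ := Nat.exists_eq_add_of_le hm
  rw [Nat.add_sub_cancel_left]
  push_cast
  rw [coe_tau, pow_add, one_div, inv_pow, inv_pow]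
  field_simp

lemma hasNormalForm_of_mem_SigmaQ {q : Quaternion ℝ} (hq : q ∈ SigmaQ) : HasNormalForm q := by
  obtain ⟨hq1, h₀, h₁, h₂, h₃⟩ := hq
  obtain ⟨n₀, h₀⟩ := exists_goldenInt_eq_div h₀
  obtain ⟨n₁, h₁⟩ := exists_goldenInt_eq_div h₁
  obtain ⟨n₂, h₂⟩ := exists_goldenInt_eq_div h₂
  obtain ⟨n₃, h₃⟩ := exists_goldenInt_eq_div h₃
  set n := n₀ + n₁ + n₂ + n₃
  obtain ⟨y₀, h₀⟩ := h₀ n (by omega)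
  obtain ⟨y₁, h₁⟩ := h₁ n (by omega)
  obtain ⟨y₂, h₂⟩ := h₂ n (by omega)
  obtain ⟨y₃, h₃⟩ := h₃ n (by omega)
  have e : q = ((1 / 2 : ℝ) ^ n) • hurwitz (2 * y₀) (y₁ - y₀) (y₂ - y₀) (y₃ - y₀) := by
    ext <;> simp [h₀, h₁, h₂, h₃]
  have hN : Quaternion.normSq q = 1 := by rw [Quaternion.normSq_eq_norm_mul_self, hq1, one_mul]
  rw [e, ← mul_one (_ • _)]
  refine hasNormalForm_one.smul_mul n isRoot_tau (IsHurwitz.isIcosian ⟨_, _, _, _, rfl⟩ _) ?_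
  rw [e, Quaternion.normSq_smul] at hN
  have h4 : ((1 / 2 : ℝ) ^ n) ^ 2 * 4 ^ n = 1 := by
    rw [← pow_mul, mul_comm n 2, pow_mul, ← mul_pow]
    norm_num
  refine mul_left_cancel₀ (a := ((1 / 2 : ℝ) ^ n) ^ 2) (by positivity) (hN.trans h4.symm)

lemma notMem_CQ_one_sub (ht : IsRoot t) {x : Quaternion ℝ} (hx : x ∈ CQ t) :
    x ∉ CQ (1 - t : goldenInt) :=
  fun hx' ↦ not_isHurwitz_of_mem_CQ hx
    (isHurwitz_of_isIcosian ht (isIcosian_of_mem_CQ hx) (isIcosian_of_mem_CQ hx'))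

lemma altStep_iff (ht : IsRoot t) {a b : Quaternion ℝ} :
    altStep a b ↔ ¬ (a ∈ CQ t ∧ b ∈ CQ t) ∧
      ¬ (a ∈ CQ (1 - t : goldenInt) ∧ b ∈ CQ (1 - t : goldenInt)) := by
  rcases ht with rfl | rfl
  · simp [altStep]
  · simp only [sub_sub_cancel]
    rw [and_comm]
    simp [altStep]

lemma mem_CQ_union_iff (ht : IsRoot t) {a : Quaternion ℝ} :
    a ∈ CQ gr ∪ CQ (1 - gr) ↔ a ∈ CQ t ∨ a ∈ CQ (1 - t : goldenInt) := by
  rcases ht with rfl | rfl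
  · simp
  · simp only [sub_sub_cancel]
    rw [or_comm]
    simp

lemma Alternating.letters_and_chain (ht : IsRoot t) {l : List (Quaternion ℝ)}
    (hl : Alternating t l) :
    (∀ a ∈ l, a ∈ CQ gr ∪ CQ (1 - gr)) ∧ List.IsChain altStep l := by
  induction l generalizing t with
  | nil => simp
  | cons a l ih =>
    obtain ⟨h₁, h₂⟩ := ih ht.one_sub hl.2
    refine ⟨List.forall_mem_cons.2 ⟨(mem_CQ_union_iff ht).2 (Or.inl hl.1), h₁⟩, ?_⟩
    cases l with
    | nil => simp
    | cons b l =>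
      refine List.isChain_cons_cons.2 ⟨(altStep_iff ht).2 ⟨fun h ↦ ?_, fun h ↦ ?_⟩, h₂⟩
      · exact notMem_CQ_one_sub ht h.2 hl.2.1
      · exact notMem_CQ_one_sub ht hl.1 h.1

lemma exists_alternating {l : List (Quaternion ℝ)} (hl : ∀ a ∈ l, a ∈ CQ gr ∪ CQ (1 - gr))
    (hl' : List.IsChain altStep l) : ∃ t, IsRoot t ∧ Alternating t l := by
  induction l with
  | nil => exact ⟨tau, isRoot_tau, trivial⟩
  | cons a l ih =>
    obtain ⟨t, ht, hat⟩ : ∃ t, IsRoot t ∧ a ∈ CQ t := by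
      rcases (mem_CQ_union_iff isRoot_tau).1 (hl a (by simp)) with h | h
      · exact ⟨_, isRoot_tau, h⟩
      · exact ⟨_, isRoot_tau.one_sub, h⟩
    refine ⟨t, ht, hat, ?_⟩
    cases l with
    | nil => trivial
    | cons b l =>
      rw [List.isChain_cons_cons] at hl'
      obtain ⟨u, hu, hub⟩ := ih (fun x hx ↦ hl x (by simp [hx])) hl'.2
      rcases hu.eq_or_eq_one_sub ht with rfl | rfl
      · exact absurd ⟨hat, hub.1⟩ ((altStep_iff hu).1 hl'.1).1
      · exact hub

end arithmetic

theorem statement17 (q : Quaternion ℝ) (hq : q ∈ SigmaQ) :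
    ∃! p : Quaternion ℝ × List (Quaternion ℝ),
      p.1 ∈ KQ ∧ (∀ a ∈ p.2, a ∈ CQ gr ∪ CQ (1 - gr)) ∧
      List.Chain' altStep p.2 ∧ q = p.1 * p.2.prod := by
  obtain ⟨t, w, l, ht, hw, hw', hl, rfl⟩ := hasNormalForm_of_mem_SigmaQ hq
  obtain ⟨h₁, h₂⟩ := hl.letters_and_chain ht
  refine ⟨(w, l), ⟨mem_KQ_iff.2 ⟨hw, hw'⟩, h₁, h₂, rfl⟩, ?_⟩
  rintro ⟨v, m⟩ ⟨hv, hm, hm', e⟩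
  dsimp only at hv hm hm' e
  obtain ⟨hv, hv'⟩ := mem_KQ_iff.1 hv
  obtain ⟨u, hu, hmu⟩ := exists_alternating hm hm'
  have e' : star v * w * l.prod = m.prod := by
    rw [mul_assoc, e, ← mul_assoc, star_mul_self_of_normSq hv', one_mul]
  obtain rfl := eq_of_mul_prod_eq ht hu (hv.star.mul hw)
    (by rw [map_mul, Quaternion.normSq_star, hv', hw', one_mul]) hl hmu e'
  rw [mul_right_cancel₀ (hl.prod_ne_zero ht) e]
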